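/- Let η be a configuration in Ω and let ξ be a fixed stack array. If α and α′ are two finite toppling sequences, both legal for η with respect to ξ, whose odometer functions coincide (h_α = h_{α′} pointwise on ℤ), then the resulting configurations coincide: Φ_α(η) = Φ_{α′}(η). (Abelian property.) -/

import Mathlib

/-!
Activated Random Walk: configurations, stacks, toppling, Abelian property.

Configurations are elements of `Ω = (ℕ ∪ {ρ})^ℤ`; `num n` means `n` active particles,
`rho` a single sleeping particle.  A stack array assigns to each site `x` and each
index `j` an instruction `τ_{x,x-1}`, `τ_{x,x+1}` or `τ_{x,ρ}` (encoded as
`left`, `right`, `sleep`).  Toppling at `x` uses the first unused instruction of the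
stack at `x` (indices start at `0`, i.e. the `(h x + 1)`-st instruction).
-/

/-- The state of a single site: `num n` = `n` active particles, `rho` = one sleeping
particle. -/
inductive ARWState where
  | num : ℕ → ARWState
  | rho : ARWState
deriving DecidableEq

/-- Configurations on `ℤ`. -/
abbrev Config := ℤ → ARWState

/-- Adding one (active) particle to a site: `ρ + 1 = 2`. -/
def ARWState.inc : ARWState → ARWState
  | .num n => .num (n + 1)
  | .rho => .num 2

/-- Removing one active particle from a site (only meaningful at unstable sites). -/
def ARWState.dec : ARWState → ARWState
  | .num (n + 1) => .num n
  | s => s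

/-- The effect of a sleep instruction `τ_{x,ρ}`: `ρ·1 = ρ`, `ρ·n = n` for `n > 1`. -/
def ARWState.toSleep : ARWState → ARWState
  | .num 1 => .rho
  | s => s

/-- A site `x` is unstable in `η` if it carries at least one active particle. -/
def Unstable (η : Config) (x : ℤ) : Prop := ∃ n : ℕ, 1 ≤ n ∧ η x = .num n

/-- The three kinds of instructions at a site `x`: `τ_{x,x-1}`, `τ_{x,x+1}`, `τ_{x,ρ}`. -/
inductive Instr where
  | left : Instr
  | right : Instr
  | sleep : Instr
deriving DecidableEq

/-- The action of an instruction at site `x` on a configuration. -/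
def applyInstr (ι : Instr) (x : ℤ) (η : Config) : Config :=
  match ι with
  | .left => fun z => if z = x then (η x).dec else if z = x - 1 then (η (x - 1)).inc else η z
  | .right => fun z => if z = x then (η x).dec else if z = x + 1 then (η (x + 1)).inc else η z
  | .sleep => fun z => if z = x then (η x).toSleep else η z

/-- A stack array `ξ = (ξ_{(x,j)})`. -/
abbrev Stacks := ℤ → ℕ → Instr

/-- One toppling at `x`, acting on a pair (configuration, odometer): it uses the first
unused instruction `ξ_{(x, h x + 1)}` of the stack at `x` and increases the odometer
at `x` by one. -/
def toppleOne (ξ : Stacks) (x : ℤ) (p : Config × (ℤ → ℕ)) : Config × (ℤ → ℕ) :=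
  (applyInstr (ξ x (p.2 x)) x p.1, Function.update p.2 x (p.2 x + 1))

/-- Toppling along a finite sequence `α = (x₁, …, x_k)`, i.e. `Φ_α = Φ_{x_k} ∘ ⋯ ∘ Φ_{x_1}`. -/
def toppleSeq (ξ : Stacks) : List ℤ → Config × (ℤ → ℕ) → Config × (ℤ → ℕ)
  | [], p => p
  | x :: α, p => toppleSeq ξ α (toppleOne ξ x p)

/-- Legality of a toppling sequence: each successive toppling happens at a site that is
unstable in the configuration at that stage. -/
def LegalFrom (ξ : Stacks) : List ℤ → Config × (ℤ → ℕ) → Prop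
  | [], _ => True
  | x :: α, p => Unstable p.1 x ∧ LegalFrom ξ α (toppleOne ξ x p)

/-- `Φ_α(η)`: the configuration resulting from toppling the sequence `α` starting from `η`
(and odometer `0`). -/
def topple (ξ : Stacks) (α : List ℤ) (η : Config) : Config :=
  (toppleSeq ξ α (η, fun _ => 0)).1

/-- `α` is a legal toppling sequence for `η` (with fresh stacks). -/
def LegalSeq (ξ : Stacks) (α : List ℤ) (η : Config) : Prop :=
  LegalFrom ξ α (η, fun _ => 0)

theorem unst_step (ι : Instr) (η : Config) (x y : ℤ) (h : y ≠ x) (hx : Unstable η x) :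
    Unstable (applyInstr ι y η) x := by
  obtain ⟨n, hn, e⟩ := hx
  have h' : x ≠ y := fun e => h e.symm
  unfold Unstable
  cases ι
  · by_cases h2 : x = y - 1
    · refine ⟨n + 1, by omega, ?_⟩
      simp only [applyInstr, if_neg h', if_pos h2]
      rw [← h2, e]; rfl
    · exact ⟨n, hn, by simp only [applyInstr, if_neg h', if_neg h2, e]⟩
  · by_cases h2 : x = y + 1
    · refine ⟨n + 1, by omega, ?_⟩
      simp only [applyInstr, if_neg h', if_pos h2]
      rw [← h2, e]; rfl
    · exact ⟨n, hn, by simp only [applyInstr, if_neg h', if_neg h2, e]⟩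
  · exact ⟨n, hn, by simp only [applyInstr, if_neg h', e]⟩

theorem dec_inc' (s : ARWState) (n : ℕ) (hn : 1 ≤ n) (h : s = .num n) :
    s.inc.dec = s.dec.inc := by
  subst h
  obtain _ | n := n
  · omega
  · rfl

theorem sleep_inc' (s : ARWState) (n : ℕ) (hn : 1 ≤ n) (h : s = .num n) :
    s.inc.toSleep = s.toSleep.inc := by
  subst h
  obtain _ | _ | n := n
  · omega
  · rfl
  · rfl

theorem instr_comm (ι κ : Instr) (η : Config) (x y : ℤ) (h : y ≠ x) (hx : Unstable η x)
    (hy : Unstable η y) :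
    applyInstr ι x (applyInstr κ y η) = applyInstr κ y (applyInstr ι x η) := by
  obtain ⟨n, hn, e⟩ := hx
  obtain ⟨m, hm, f⟩ := hy
  have a1 := dec_inc' _ n hn e
  have a2 := dec_inc' _ m hm f
  have a3 := sleep_inc' _ n hn e
  have a4 := sleep_inc' _ m hm f
  clear e f hn hm
  funext z
  cases ι <;> cases κ <;> simp only [applyInstr] <;> grind

theorem topple_comm (ξ : Stacks) (p : Config × (ℤ → ℕ)) (x y : ℤ) (h : y ≠ x)
    (hx : Unstable p.1 x) (hy : Unstable p.1 y) :
    toppleOne ξ x (toppleOne ξ y p) = toppleOne ξ y (toppleOne ξ x p) := by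
  have h' : x ≠ y := fun e => h e.symm
  simp only [toppleOne, Function.update_of_ne h, Function.update_of_ne h']
  rw [instr_comm _ _ _ _ _ h hx hy, Function.update_comm h]

theorem move_front (ξ : Stacks) (x : ℤ) (β : List ℤ) : ∀ p : Config × (ℤ → ℕ),
    Unstable p.1 x → LegalFrom ξ β p → x ∈ β →
    LegalFrom ξ (β.erase x) (toppleOne ξ x p) ∧
      toppleSeq ξ (β.erase x) (toppleOne ξ x p) = toppleSeq ξ β p := by
  induction β with
  | nil => intro p _ _ h; simp at h
  | cons y β ih =>
    intro p hx hl hm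
    by_cases h : y = x
    · subst h
      rw [List.erase_cons_head]
      exact ⟨hl.2, rfl⟩
    · have hm' : x ∈ β := by
        rcases List.mem_cons.1 hm with h1 | h1
        · exact absurd h1.symm h
        · exact h1
      obtain ⟨i1, i2⟩ := ih (toppleOne ξ y p) (unst_step _ _ _ _ h hx) hl.2 hm'
      rw [topple_comm ξ p x y h hx hl.1] at i1 i2
      rw [List.erase_cons_tail (by simpa using h)]
      exact ⟨⟨unst_step _ _ _ _ (fun e => h e.symm) hl.1, i1⟩, i2⟩

theorem abelian_perm (ξ : Stacks) (α : List ℤ) : ∀ (β : List ℤ) (p : Config × (ℤ → ℕ)),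
    LegalFrom ξ α p → LegalFrom ξ β p → α.Perm β → toppleSeq ξ α p = toppleSeq ξ β p := by
  induction α with
  | nil => intro β p _ _ h; rw [List.nil_perm.1 h]
  | cons x α ih =>
    intro β p ha hb h
    obtain ⟨hm, hp⟩ := List.cons_perm_iff_perm_erase.1 h
    obtain ⟨i1, i2⟩ := move_front ξ x β p ha.1 hb hm
    rw [← i2]
    exact ih _ _ ha.2 i1 hp

/-- **Abelian property.**  If two toppling sequences are both legal for `η` and have the same
odometer function `h_α(x) = #{i : x_i = x}`, then they produce the same final configuration. -/
theorem abelian_property (ξ : Stacks) (η : Config) (α α' : List ℤ)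
    (hα : LegalSeq ξ α η) (hα' : LegalSeq ξ α' η)
    (hodo : ∀ x : ℤ, α.count x = α'.count x) :
    topple ξ α η = topple ξ α' η := by
  unfold topple
  rw [abelian_perm ξ α α' _ hα hα' (List.perm_iff_count.2 hodo)]
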